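/- arXiv:2511.01162 — 5 statements merged into one kernel-verified Lean document; each statement's English description precedes it below -/
import Mathlib

section
/- Let F be a field, let m, n, a, s, b be positive integers, and let e₁ : {0,…,m−1} → ℕ and e₂ : {0,…,n−1} → ℕ be functions such that the map (i, j) ↦ e₁(i) + e₂(j) is injective on {0,…,m−1} × {0,…,n−1}. Let A_i be a×s matrices over F for 0 ≤ i ≤ m−1 and B_j be s×b matrices over F for 0 ≤ j ≤ n−1. Define matrices over the polynomial ring F[X] by f = Σ_{i=0}^{m−1} X^{e₁(i)} · (A_i mapped into F[X]) and g = Σ_{j=0}^{n−1} X^{e₂(j)} · (B_j mapped into F[X]). Then for every pair (i, j), the coefficient matrix of X^{e₁(i)+e₂(j)} in the matrix product f·g equals A_i · B_j. -/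
open Polynomial

/-- Correctness of polynomial codes: if the exponent map `(i, j) ↦ e₁ i + e₂ j` is
injective, then each submatrix product `A i * B j` is recovered as the coefficient
matrix of `X ^ (e₁ i + e₂ j)` in the product `f * g`, where
`f = Σ_i X^(e₁ i) • (A i).map C` and `g = Σ_j X^(e₂ j) • (B j).map C`. -/
theorem polynomial_code_coeff_eq
    {F : Type*} [Field F] (m n a s b : ℕ)
    (hm : 0 < m) (hn : 0 < n) (ha : 0 < a) (hs : 0 < s) (hb : 0 < b)
    (e₁ : Fin m → ℕ) (e₂ : Fin n → ℕ)
    (hinj : Function.Injective (fun p : Fin m × Fin n => e₁ p.1 + e₂ p.2))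
    (A : Fin m → Matrix (Fin a) (Fin s) F)
    (B : Fin n → Matrix (Fin s) (Fin b) F) :
    ∀ (i : Fin m) (j : Fin n),
      ((∑ i' : Fin m, (X ^ e₁ i' : F[X]) • (A i').map C) *
          (∑ j' : Fin n, (X ^ e₂ j' : F[X]) • (B j').map C)).map
        (fun p => p.coeff (e₁ i + e₂ j)) = A i * B j := by
  intro i j
  have hprod :
      (∑ i' : Fin m, (X ^ e₁ i' : F[X]) • (A i').map C) *
          (∑ j' : Fin n, (X ^ e₂ j' : F[X]) • (B j').map C) =
        ∑ p : Fin m × Fin n, (X ^ (e₁ p.1 + e₂ p.2) : F[X]) • (A p.1 * B p.2).map C := by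
    simp_rw [Matrix.sum_mul, Matrix.mul_sum, Fintype.sum_prod_type, Matrix.map_mul, pow_add, mul_smul,
      Matrix.smul_mul, Matrix.mul_smul]
  ext k l
  rw [hprod, Matrix.map_apply, Matrix.sum_apply, finsetSum_coeff,
    Finset.sum_eq_single (i, j)]
  · simp [-Matrix.map_mul, coeff_X_pow]
  · intro p _ hp
    have hne : e₁ i + e₂ j ≠ e₁ p.1 + e₂ p.2 := fun h => hp (hinj h.symm)
    simp [-Matrix.map_mul, coeff_X_pow, hne]
  · simp
end

section
/- Let F be a field and let m, n, a, s, b be positive integers. Let A_i be a×s matrices over F for 0 ≤ i ≤ m−1 and B_j be s×b matrices over F for 0 ≤ j ≤ n−1. Define matrices over the polynomial ring F[X] by f = Σ_{i=0}^{m−1} X^{i} · (A_i mapped into F[X]) and g = Σ_{j=0}^{n−1} X^{m·j} · (B_j mapped into F[X]). Then for every pair (i, j) with 0 ≤ i ≤ m−1 and 0 ≤ j ≤ n−1, the coefficient matrix of X^{i+m·j} in the matrix product f·g equals A_i · B_j. -/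
open Polynomial

/-- Base-`m` digits are unique: `(i, j) ↦ i + m * j` is injective for `i < m`. -/
theorem Fin.val_add_mul_val_inj {m n : ℕ} {i i' : Fin m} {j j' : Fin n} :
    (i : ℕ) + m * j = i' + m * j' ↔ i = i' ∧ j = j' := by
  refine ⟨fun h => ?_, by rintro ⟨rfl, rfl⟩; rfl⟩
  have hmod := congrArg (· % m) h
  simp only [Nat.add_mul_mod_self_left, Nat.mod_eq_of_lt i.isLt, Nat.mod_eq_of_lt i'.isLt] at hmod
  rw [hmod, Nat.add_left_cancel_iff, Nat.mul_right_inj i.pos.ne'] at h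
  exact ⟨Fin.ext hmod, Fin.ext h⟩

/-- The classical polynomial-code construction of Yu–Maddah-Ali–Avestimehr:
with `f = Σ_i X^i • (A i).map C` and `g = Σ_j X^(m*j) • (B j).map C`, each
submatrix product `A i * B j` is the coefficient matrix of `X ^ (i + m * j)`
in the product `f * g`. -/
theorem classical_polynomial_code_coeff_eq
    {F : Type*} [Field F] (m n a s b : ℕ)
    (hm : 0 < m) (hn : 0 < n) (ha : 0 < a) (hs : 0 < s) (hb : 0 < b)
    (A : Fin m → Matrix (Fin a) (Fin s) F)
    (B : Fin n → Matrix (Fin s) (Fin b) F) :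
    ∀ (i : Fin m) (j : Fin n),
      ((∑ i' : Fin m, (X ^ (i' : ℕ) : F[X]) • (A i').map C) *
          (∑ j' : Fin n, (X ^ (m * (j' : ℕ)) : F[X]) • (B j').map C)).map
        (fun p => p.coeff ((i : ℕ) + m * (j : ℕ))) = A i * B j := by
  intro i j
  have hprod : (∑ i' : Fin m, (X ^ (i' : ℕ) : F[X]) • (A i').map C) *
      (∑ j' : Fin n, (X ^ (m * (j' : ℕ)) : F[X]) • (B j').map C) =
      ∑ i' : Fin m, ∑ j' : Fin n,
        (X ^ ((i' : ℕ) + m * (j' : ℕ)) : F[X]) • (A i' * B j').map C := by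
    simp only [Matrix.sum_mul, Matrix.mul_sum]
    rw [Finset.sum_comm]
    simp only [Matrix.smul_mul, Matrix.mul_smul, smul_smul, ← pow_add, Matrix.map_mul,
      add_comm]
  ext k l
  simp only [hprod, Matrix.map_apply, Matrix.sum_apply, Matrix.smul_apply, smul_eq_mul,
    finsetSum_coeff, mul_comm (X ^ _) (C _), coeff_C_mul_X_pow, Fin.val_add_mul_val_inj, ite_and]
  simp
end

section
/- Let F be a field, let m, r, s, t be positive integers, let e₁, e₂ : {0,…,m−1} → ℕ be functions, and let d ∈ ℕ be such that e₁(i) + e₂(j) = d if and only if i = j. Let A_i be r×s matrices over F and B_j be s×t matrices over F for 0 ≤ i, j ≤ m−1. Define matrices over the polynomial ring F[X] by f = Σ_{i=0}^{m−1} X^{e₁(i)} · (A_i mapped into F[X]) and g = Σ_{j=0}^{m−1} X^{e₂(j)} · (B_j mapped into F[X]). Then the coefficient matrix of X^{d} in the matrix product f·g equals Σ_{i=0}^{m−1} A_i · B_i. -/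
open Polynomial

/-- The coefficient matrix of `X ^ d` in `X ^ k • M`, for a constant matrix `M`, is `M` if
`k = d` and `0` otherwise. -/
theorem Matrix.map_coeff_X_pow_smul_map_C {R l n : Type*} [Semiring R] (k d : ℕ)
    (M : Matrix l n R) :
    ((X ^ k : R[X]) • M.map C).map (fun p => p.coeff d) = if k = d then M else 0 := by
  ext a b
  split_ifs with h <;> simp [coeff_X_pow, eq_comm (a := d), h]

/-- Correctness of Matdot codes: if `e₁ i + e₂ j = d` exactly when `i = j`, then the
coefficient matrix of `X ^ d` in the product `f * g` equals `Σ_i A i * B i`, where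
`f = Σ_i X^(e₁ i) • (A i).map C` and `g = Σ_j X^(e₂ j) • (B j).map C`. -/
theorem matdot_code_coeff_eq
    {F : Type*} [Field F] (m r s t : ℕ)
    (hm : 0 < m) (hr : 0 < r) (hs : 0 < s) (ht : 0 < t)
    (e₁ e₂ : Fin m → ℕ) (d : ℕ)
    (hd : ∀ i j : Fin m, e₁ i + e₂ j = d ↔ i = j)
    (A : Fin m → Matrix (Fin r) (Fin s) F)
    (B : Fin m → Matrix (Fin s) (Fin t) F) :
    ((∑ i : Fin m, (X ^ e₁ i : F[X]) • (A i).map C) *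
        (∑ j : Fin m, (X ^ e₂ j : F[X]) • (B j).map C)).map
      (fun p => p.coeff d) = ∑ i : Fin m, A i * B i := by
  have hprod (i j : Fin m) :
      ((X ^ e₁ i : F[X]) • (A i).map C) * ((X ^ e₂ j : F[X]) • (B j).map C) =
        (X ^ (e₁ i + e₂ j) : F[X]) • (A i * B j).map C := by
    rw [Matrix.map_mul, Matrix.smul_mul, Matrix.mul_smul, smul_smul, pow_add]
  have hsum {ι : Type} (u : Finset ι) (P : ι → Matrix (Fin r) (Fin t) F[X]) :
      (∑ i ∈ u, P i).map (fun p => p.coeff d) = ∑ i ∈ u, (P i).map (fun p => p.coeff d) :=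
    map_sum (lcoeff F d).toAddMonoidHom.mapMatrix P u
  simp only [Matrix.sum_mul, Matrix.mul_sum, hprod, hsum, Matrix.map_coeff_X_pow_smul_map_C,
    hd, Finset.sum_ite_eq', Finset.mem_univ, if_true]
end

section
/- Let q be a prime power, 𝔽_q the finite field with q elements, and m a positive integer with gcd(m, q) = 1. Let ℓ ≥ 2 and let a_1,…,a_ℓ, b_1,…,b_{ℓ−1} be pairwise distinct elements of 𝔽_q. Let u = (∏_{i=1}^{ℓ} (X − a_i)) / (∏_{i=1}^{ℓ−1} (X − b_i)) be the corresponding element of the rational function field 𝔽_q(X). Then the polynomial Y^m − u is irreducible in 𝔽_q(X)[Y]. -/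
open Polynomial

/-- If `r` and `s` are coprime and some prime divides `r` exactly once, then `s * X ^ m - r` is
primitive and irreducible, by Eisenstein's criterion. -/
theorem isPrimitive_and_irreducible_C_mul_X_pow_sub_C {R : Type*} [CommRing R] [IsDomain R]
    {m : ℕ} (hm : 0 < m) {p r s : R} (hp : Prime p) (hrs : IsCoprime r s) (hpr : p ∣ r)
    (hpr' : ¬p ^ 2 ∣ r) :
    (C s * X ^ m - C r).IsPrimitive ∧ Irreducible (C s * X ^ m - C r) := by
  have hps : ¬p ∣ s := fun h ↦ hp.not_isUnit (hrs.isUnit_of_dvd' hpr h)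
  have hs : s ≠ 0 := by
    rintro rfl
    exact hps (dvd_zero p)
  have coeff_zero_eq : (C s * X ^ m - C r).coeff 0 = -r := by
    simp [coeff_X_pow, hm.ne]
  have coeff_m_eq : (C s * X ^ m - C r).coeff m = s := by
    simp [coeff_C, hm.ne']
  have natDegree_eq : (C s * X ^ m - C r).natDegree = m := by
    rw [natDegree_sub_C, natDegree_C_mul_X_pow m s hs]
  have isPrimitive : (C s * X ^ m - C r).IsPrimitive := by
    intro d hd
    rw [C_dvd_iff_dvd_coeff] at hd
    refine hrs.isUnit_of_dvd' ?_ (coeff_m_eq ▸ hd m)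
    rw [← dvd_neg, ← coeff_zero_eq]
    exact hd 0
  refine ⟨isPrimitive, IsEisensteinAt.irreducible (𝓟 := Ideal.span {p}) ⟨?_, ?_, ?_⟩
    ((Ideal.span_singleton_prime hp.ne_zero).2 hp) isPrimitive (natDegree_eq.symm ▸ hm)⟩
  · rwa [leadingCoeff, natDegree_eq, coeff_m_eq, Ideal.mem_span_singleton]
  · intro n hn
    rw [natDegree_eq] at hn
    rw [Ideal.mem_span_singleton, coeff_sub, coeff_C_mul, coeff_X_pow, if_neg hn.ne, mul_zero,
      zero_sub, dvd_neg, coeff_C]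
    split_ifs
    exacts [hpr, dvd_zero p]
  · rwa [coeff_zero_eq, Ideal.span_singleton_pow, Ideal.mem_span_singleton, dvd_neg]

/-- If `r` and `s` are coprime and some prime divides `r` exactly once, then `X ^ m - r / s` is
irreducible over the field of fractions. -/
theorem irreducible_X_pow_sub_C_div {R K : Type*} [CommRing R] [IsDomain R]
    [IsGCDMonoid R] [Field K] [Algebra R K] [IsFractionRing R K] {m : ℕ} (hm : 0 < m)
    {p r s : R} (hp : Prime p) (hrs : IsCoprime r s) (hpr : p ∣ r) (hpr' : ¬p ^ 2 ∣ r) :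
    Irreducible ((X : K[X]) ^ m - C (algebraMap R K r / algebraMap R K s)) := by
  have hs : s ≠ 0 := by
    rintro rfl
    exact hp.not_isUnit (hrs.isUnit_of_dvd' hpr (dvd_zero p))
  have hs' : algebraMap R K s ≠ 0 := by simpa using hs
  obtain ⟨h, h'⟩ := isPrimitive_and_irreducible_C_mul_X_pow_sub_C hm hp hrs hpr hpr'
  rw [h.irreducible_iff_irreducible_map_fraction_map (K := K)] at h'
  have key : (C s * X ^ m - C r).map (algebraMap R K) =
      C (algebraMap R K s) * (X ^ m - C (algebraMap R K r / algebraMap R K s)) := by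
    rw [mul_sub, ← C_mul, mul_div_cancel₀ _ hs']
    simp
  rwa [key, irreducible_isUnit_mul (isUnit_C.2 hs'.isUnit)] at h'

/-- Kummer irreducibility underlying the `(m,n)`-friendly function fields: for a finite
field `𝔽_q` (so `q = |𝔽_q|` is a prime power), `m` coprime to `q`, and pairwise distinct
elements `a_1, …, a_ℓ, b_1, …, b_{ℓ-1}` of `𝔽_q`, the polynomial
`Y^m - (∏ (X - a_i)) / (∏ (X - b_i))` is irreducible over the rational function field
`𝔽_q(X)`. -/
theorem kummer_irreducible_poly_friendly
    {Fq : Type*} [Field Fq] [Fintype Fq]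
    (m : ℕ) (hm : 0 < m) (hcop : Nat.Coprime m (Fintype.card Fq))
    (ℓ : ℕ) (hℓ : 2 ≤ ℓ)
    (a : Fin ℓ → Fq) (b : Fin (ℓ - 1) → Fq)
    (ha : Function.Injective a) (hb : Function.Injective b)
    (hab : ∀ i j, a i ≠ b j) :
    Irreducible
      ((X : (RatFunc Fq)[X]) ^ m -
        C ((algebraMap (Polynomial Fq) (RatFunc Fq)
              (∏ i : Fin ℓ, (X - C (a i)))) /
           (algebraMap (Polynomial Fq) (RatFunc Fq)
              (∏ i : Fin (ℓ - 1), (X - C (b i)))))) := by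
  classical
  let i₀ : Fin ℓ := ⟨0, by lia⟩
  refine irreducible_X_pow_sub_C_div hm (prime_X_sub_C (a i₀)) ?_
    (Finset.dvd_prod_of_mem _ (Finset.mem_univ i₀)) ?_
  · exact IsCoprime.prod_left fun i _ ↦ IsCoprime.prod_right fun j _ ↦
      isCoprime_X_sub_C_of_isUnit_sub (sub_ne_zero.2 (hab i j)).isUnit
  · rw [← Finset.mul_prod_erase _ _ (Finset.mem_univ i₀), sq,
      mul_dvd_mul_iff_left (X_sub_C_ne_zero _), (prime_X_sub_C (a i₀)).dvd_finsetProd_iff]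
    rintro ⟨i, hi, hdvd⟩
    rw [dvd_iff_isRoot, root_X_sub_C] at hdvd
    exact Finset.ne_of_mem_erase hi (ha hdvd)
end

section
/- Let p be a prime, q a power of p, and u ≥ 2 an integer. Let ℓ ≥ 2 and let a_1,…,a_ℓ, b_1,…,b_{ℓ−1} be pairwise distinct elements of 𝔽_q. Let r = (∏_{i=1}^{ℓ} (X − a_i)) / (∏_{i=1}^{ℓ−1} (X − b_i)) be the corresponding element of the rational function field 𝔽_q(X). Then the polynomial Σ_{i=0}^{u−1} Y^{p^i} − r (that is, Y^{p^{u−1}} + Y^{p^{u−2}} + ⋯ + Y^p + Y − r) is irreducible in 𝔽_q(X)[Y]. -/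
open Polynomial

namespace Polynomial

/-- A primitive polynomial over a domain is irreducible if its reverse is. -/
theorem IsPrimitive.irreducible_of_irreducible_reverse {R : Type*} [CommRing R] [IsDomain R]
    {f : R[X]} (hf : f.IsPrimitive) (h0 : f.coeff 0 ≠ 0) (hr : Irreducible f.reverse) :
    Irreducible f := by
  have isUnit_of_dvd {g : R[X]} (hg : g ∣ f) (hu : IsUnit g.reverse) : IsUnit g := by
    have hg0 : g.coeff 0 ≠ 0 := by
      obtain ⟨k, rfl⟩ := hg
      rw [mul_coeff_zero] at h0
      exact left_ne_zero_of_mul h0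
    have hdeg : g.natDegree = 0 := by
      have := natDegree_eq_zero_of_isUnit hu
      rw [reverse_natDegree, natTrailingDegree_eq_zero.2 (Or.inr hg0)] at this
      exact this
    rw [eq_C_of_natDegree_eq_zero hdeg] at hg ⊢
    exact (hf _ hg).map C
  refine ⟨fun hu => hr.not_isUnit ?_, fun g h hgh => ?_⟩
  · obtain ⟨c, hc, rfl⟩ := isUnit_iff.1 hu
    rw [reverse_C]
    exact hu
  · have := hr.isUnit_or_isUnit (a := g.reverse) (b := h.reverse)
      (by rw [hgh, reverse_mul_of_domain])
    exact this.imp (isUnit_of_dvd (hgh ▸ dvd_mul_right _ _))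
      (isUnit_of_dvd (hgh ▸ dvd_mul_left _ _))

/-- **Eisenstein's criterion** for the reversed polynomial: the roles of the leading and the
constant coefficient are exchanged. -/
theorem irreducible_of_eisenstein_criterion_reverse {R : Type*} [CommRing R] [IsDomain R]
    {f : R[X]} {P : Ideal R} (hP : P.IsPrime) (h0 : f.coeff 0 ∉ P)
    (hfP : ∀ n, n ≠ 0 → f.coeff n ∈ P) (hdeg : 0 < f.natDegree)
    (hlead : f.leadingCoeff ∉ P ^ 2) (hf : f.IsPrimitive) : Irreducible f := by
  have hc0 : f.coeff 0 ≠ 0 := fun h => h0 (h ▸ P.zero_mem)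
  have htd : f.natTrailingDegree = 0 := natTrailingDegree_eq_zero.2 (Or.inr hc0)
  have hrdeg : f.reverse.natDegree = f.natDegree := by rw [reverse_natDegree, htd, Nat.sub_zero]
  refine hf.irreducible_of_irreducible_reverse hc0
    (irreducible_of_eisenstein_criterion hP ?_ ?_ ?_ ?_ ?_)
  · rwa [reverse_leadingCoeff, trailingCoeff, htd]
  · intro n hn
    have hn' : n < f.natDegree := hrdeg ▸ coe_lt_degree.1 hn
    rw [coeff_reverse, revAt_le hn'.le]
    exact hfP _ (by omega)
  · rw [← natDegree_pos_iff_degree_pos, hrdeg]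
    exact hdeg
  · rwa [coeff_zero_reverse]
  · intro r hr
    refine hf r ((C_dvd_iff_dvd_coeff _ _).2 fun n => ?_)
    simpa [coeff_reverse] using (C_dvd_iff_dvd_coeff _ _).1 hr (revAt f.natDegree n)

/-- If `A` and `B` are coprime and some prime divides `B` exactly once, then
`Y ^ p ^ (u - 1) + ⋯ + Y ^ p + Y - A / B` is irreducible. -/
theorem irreducible_sum_X_pow_sub_C_div {R K : Type*} [CommRing R] [IsDomain R]
    [NormalizedGCDMonoid R] [Field K] [Algebra R K] [IsFractionRing R K] {p u : ℕ} (hp : 1 < p)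
    (hu : 0 < u) {A B π : R} (hAB : IsCoprime A B) (hπ : Prime π) (hπB : π ∣ B)
    (hπB' : ¬ π ^ 2 ∣ B) :
    Irreducible ((∑ i ∈ Finset.range u, (X : K[X]) ^ p ^ i) -
      C (algebraMap R K A / algebraMap R K B)) := by
  have hB : B ≠ 0 := by
    rintro rfl
    exact hπB' (dvd_zero _)
  have hBK : algebraMap R K B ≠ 0 := (map_ne_zero_iff _ (IsFractionRing.injective R K)).2 hB
  set f : R[X] := C B * ∑ i ∈ Finset.range u, X ^ p ^ i - C A with hf_def
  have hpi (i : ℕ) : p ^ i ≠ 0 := pow_ne_zero _ (by omega)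
  have coeff_zero : f.coeff 0 = -A := by
    simp [hf_def, coeff_X_pow, (hpi _).symm]
  have coeff_of_ne_zero {n : ℕ} (hn : n ≠ 0) :
      f.coeff n = B * ∑ i ∈ Finset.range u, if n = p ^ i then 1 else 0 := by
    simp only [hf_def, coeff_sub, coeff_C_mul, finsetSum_coeff, coeff_X_pow, coeff_C, if_neg hn,
      sub_zero]
  have coeff_top : f.coeff (p ^ (u - 1)) = B := by
    rw [coeff_of_ne_zero (hpi _), Finset.sum_eq_single (u - 1), if_pos rfl, mul_one]
    · intro i _ hi
      exact if_neg fun h => hi (Nat.pow_right_injective hp h).symm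
    · intro h
      exact absurd (Finset.mem_range.2 (by omega)) h
  have natDegree_f : f.natDegree = p ^ (u - 1) := by
    refine natDegree_eq_of_le_of_coeff_ne_zero ?_ (coeff_top ▸ hB)
    refine natDegree_le_iff_coeff_eq_zero.2 fun n hn => ?_
    rw [coeff_of_ne_zero (by omega), Finset.sum_eq_zero, mul_zero]
    intro i hi
    refine if_neg fun h => ?_
    have := Nat.pow_le_pow_right (show 0 < p by omega)
      (show i ≤ u - 1 by have := Finset.mem_range.1 hi; omega)
    omega
  have hprim : f.IsPrimitive := by
    intro r hr
    rw [C_dvd_iff_dvd_coeff] at hr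
    exact hAB.isUnit_of_dvd' ((dvd_neg).1 (coeff_zero ▸ hr 0)) (coeff_top ▸ hr _)
  have hf : Irreducible f := by
    refine irreducible_of_eisenstein_criterion_reverse
      ((Ideal.span_singleton_prime hπ.ne_zero).2 hπ) ?_ ?_ ?_ ?_ hprim
    · rw [coeff_zero, Ideal.mem_span_singleton, dvd_neg]
      exact fun h => hπ.not_isUnit (hAB.isUnit_of_dvd' h hπB)
    · intro n hn
      rw [coeff_of_ne_zero hn, Ideal.mem_span_singleton]
      exact hπB.mul_right _
    · rw [natDegree_f]
      exact Nat.pos_of_ne_zero (hpi _)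
    · rwa [leadingCoeff, natDegree_f, coeff_top, Ideal.span_singleton_pow,
        Ideal.mem_span_singleton]
  rw [hprim.irreducible_iff_irreducible_map_fraction_map (K := K)] at hf
  have hmap : f.map (algebraMap R K) = C (algebraMap R K B) *
      ((∑ i ∈ Finset.range u, (X : K[X]) ^ p ^ i) -
        C (algebraMap R K A / algebraMap R K B)) := by
    rw [mul_sub, ← C_mul, mul_div_cancel₀ _ hBK]
    simp [hf_def, Polynomial.map_sum]
  rwa [hmap, irreducible_isUnit_mul ((isUnit_iff_ne_zero.2 hBK).map C)] at hf

end Polynomial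

/-- Artin–Schreier-type irreducibility underlying Theorem 3: for a finite field `𝔽_q`
of characteristic `p` (so `q` is a power of `p`), `u ≥ 2`, and pairwise distinct
elements `a_1, …, a_ℓ, b_1, …, b_{ℓ-1}` of `𝔽_q`, the polynomial
`Y^{p^{u-1}} + ⋯ + Y^p + Y - (∏ (X - a_i)) / (∏ (X - b_i))` (the trace polynomial of
`𝔽_{p^u}/𝔽_p` in `Y` minus the rational function) is irreducible over `𝔽_q(X)`. -/
theorem trace_polynomial_irreducible
    {Fq : Type*} [Field Fq] [Fintype Fq]
    (p : ℕ) (hp : p.Prime) [CharP Fq p]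
    (u : ℕ) (hu : 2 ≤ u)
    (ℓ : ℕ) (hℓ : 2 ≤ ℓ)
    (a : Fin ℓ → Fq) (b : Fin (ℓ - 1) → Fq)
    (ha : Function.Injective a) (hb : Function.Injective b)
    (hab : ∀ i j, a i ≠ b j) :
    Irreducible
      ((∑ i ∈ Finset.range u, (X : (RatFunc Fq)[X]) ^ p ^ i) -
        C ((algebraMap (Polynomial Fq) (RatFunc Fq)
              (∏ i : Fin ℓ, (X - C (a i)))) /
           (algebraMap (Polynomial Fq) (RatFunc Fq)
              (∏ i : Fin (ℓ - 1), (X - C (b i)))))) := by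
  classical
  let j₀ : Fin (ℓ - 1) := ⟨0, by omega⟩
  have hsq : Squarefree (∏ i : Fin (ℓ - 1), (X - C (b i))) :=
    (separable_prod_X_sub_C_iff.2 hb).squarefree
  refine irreducible_sum_X_pow_sub_C_div hp.one_lt (by omega) ?_ (prime_X_sub_C (b j₀))
    (Finset.dvd_prod_of_mem _ (Finset.mem_univ j₀)) fun h => ?_
  · exact IsCoprime.prod_left fun i _ => IsCoprime.prod_right fun j _ =>
      isCoprime_X_sub_C_of_isUnit_sub (sub_ne_zero.2 (hab i j)).isUnit
  · exact not_isUnit_X_sub_C _ (hsq _ (pow_two (X - C (b j₀)) ▸ h))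
end
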